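/- For any σ², σ̃² > 0, a ∈ ℝ, and ε > 0, setting ρ = (a²σ² + ε)/(a²σ̃² + ε) and ρ₀ = σ²/σ̃², one has ρ − log ρ ≤ ρ₀ − log ρ₀; moreover a²(m − m̃)²/(a²σ̃² + ε) ≤ (m − m̃)²/σ̃² for all m, m̃ ∈ ℝ. -/

import Mathlib

/-- If `x` lies between `1` and `y`, then `x - log x ≤ y - log y`. -/
theorem Real.sub_log_le_sub_log_of_between {x y : ℝ} (hx : 0 < x) (hy : 0 < y)
    (h : 0 ≤ (y - x) * (x - 1)) : x - Real.log x ≤ y - Real.log y := by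
  have hlog : Real.log y - Real.log x ≤ y / x - 1 := by
    rw [← Real.log_div hy.ne' hx.ne']
    exact Real.log_le_sub_one_of_pos (div_pos hy hx)
  have hdiff : y - x - (y / x - 1) = (y - x) * (x - 1) / x := by
    field_simp
  have hnonneg : 0 ≤ (y - x) * (x - 1) / x := div_nonneg h hx.le
  linarith

/-- Scalar inequalities underlying the monotonicity of the Kullback–Leibler divergence
between one-dimensional Gaussians under an affine-plus-noise transformation:
with `ρ = (a²σ² + ε)/(a²σ̃² + ε)` and `ρ₀ = σ²/σ̃²` one has `ρ - log ρ ≤ ρ₀ - log ρ₀`,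
and `a²(m - m̃)²/(a²σ̃² + ε) ≤ (m - m̃)²/σ̃²`. -/
theorem stmt_15 (σ2 σt2 : ℝ) (hσ2 : 0 < σ2) (hσt2 : 0 < σt2) (a ε : ℝ) (hε : 0 < ε) :
    ((a ^ 2 * σ2 + ε) / (a ^ 2 * σt2 + ε) - Real.log ((a ^ 2 * σ2 + ε) / (a ^ 2 * σt2 + ε))
        ≤ σ2 / σt2 - Real.log (σ2 / σt2)) ∧
      ∀ m mt : ℝ, a ^ 2 * (m - mt) ^ 2 / (a ^ 2 * σt2 + ε) ≤ (m - mt) ^ 2 / σt2 := by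
  have hden : 0 < a ^ 2 * σt2 + ε := by positivity
  refine ⟨Real.sub_log_le_sub_log_of_between (by positivity) (by positivity) ?_, fun m mt => ?_⟩
  · have hprod : (σ2 / σt2 - (a ^ 2 * σ2 + ε) / (a ^ 2 * σt2 + ε)) *
        ((a ^ 2 * σ2 + ε) / (a ^ 2 * σt2 + ε) - 1) =
        a ^ 2 * ε * (σ2 - σt2) ^ 2 / (σt2 * (a ^ 2 * σt2 + ε) ^ 2) := by
      field_simp
      ring
    rw [hprod]
    positivity
  · rw [div_le_div_iff₀ hden hσt2]
    nlinarith [mul_nonneg hε.le (sq_nonneg (m - mt))]
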